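/- (Pointwise elliptic case with symmetric integrable kernels.) Let A ≥ 0 and R > 2ρ > 0, and let u ∈ L^∞(ℝ^d) be continuous on B_R and satisfy, for every x ∈ B_R, sup_{K ∈ S_ρ} ∫_{ℝ^d} (u(x+y) + u(x−y) − 2u(x)) K(y) dy ≥ −A and inf_{K ∈ S_ρ} ∫_{ℝ^d} (u(x+y) + u(x−y) − 2u(x)) K(y) dy ≤ A (all integrals existing since every K ∈ S_ρ is integrable and u is bounded). Then there exist α ∈ (0, 2s) and C > 0 depending only on d, s, λ and Λ such that for all x, y ∈ B_{R/4} with |x−y| ≥ ρ, |u(x) − u(y)| / |x−y|^α ≤ (C/R^α)(‖u‖_{L^∞(ℝ^d)} + R^{2s} A). -/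

import Mathlib

open MeasureTheory Metric Set
open scoped Classical

noncomputable section

abbrev Ed (d : ℕ) := EuclideanSpace ℝ (Fin d)

/-- `min{|y|^{-d-2s}, ρ^{-d-2s}}`, with the convention that it equals `|y|^{-d-2s}` when `ρ = 0`. -/
def truncKer (d : ℕ) (s ρ : ℝ) (y : Ed d) : ℝ :=
  if ρ = 0 then ‖y‖ ^ (-(d : ℝ) - 2 * s)
  else min (‖y‖ ^ (-(d : ℝ) - 2 * s)) (ρ ^ (-(d : ℝ) - 2 * s))

/-- The kernel class `𝒦_ρ` with ellipticity constants `lam ≤ Lam` and order `2s`. -/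
def KernelClass (d : ℕ) (s lam Lam ρ : ℝ) : Set (Ed d → ℝ) :=
  {K | Measurable K ∧ (∀ y, 0 ≤ K y) ∧
    (∀ y : Ed d, y ≠ 0 → lam * truncKer d s ρ y ≤ K y) ∧
    (∀ r : ℝ, 0 < r →
      ∫⁻ y in ball (0 : Ed d) (2 * r) \ ball 0 r, ENNReal.ofReal (K y) ≤
        ENNReal.ofReal (Lam * r ^ (-(2 * s)))) ∧
    (s = 1 / 2 → ∀ r : ℝ, 0 < r →
      (∫ y in ball (0 : Ed d) (2 * r) \ ball 0 r, K y • y) = (0 : Ed d))}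

/-- The increment `δ_y u (x)`, whose form depends on whether `s < 1/2`, `s = 1/2` or `s > 1/2`. -/
def incr (d : ℕ) (s : ℝ) (u : Ed d → ℝ) (x y : Ed d) : ℝ :=
  if s < 1 / 2 then u (x + y) - u x
  else if s = 1 / 2 then u (x + y) - u x - (if ‖y‖ < 1 then fderiv ℝ u x y else 0)
  else u (x + y) - u x - fderiv ℝ u x y

/-- The linear integro-differential operator `L_K u (x) = ∫ δ_y u(x) K(y) dy`. -/
def opL (d : ℕ) (s : ℝ) (K u : Ed d → ℝ) (x : Ed d) : ℝ :=
  ∫ y, incr d s u x y * K y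

/-- Pucci extremal operator `M_ρ^- u(x) = inf_{K ∈ 𝒦_ρ} L_K u (x)`. -/
def pucciInf (d : ℕ) (s lam Lam ρ : ℝ) (u : Ed d → ℝ) (x : Ed d) : ℝ :=
  sInf ((fun K => opL d s K u x) '' KernelClass d s lam Lam ρ)

/-- Pucci extremal operator `M_ρ^+ u(x) = sup_{K ∈ 𝒦_ρ} L_K u (x)`. -/
def pucciSup (d : ℕ) (s lam Lam ρ : ℝ) (u : Ed d → ℝ) (x : Ed d) : ℝ :=
  sSup ((fun K => opL d s K u x) '' KernelClass d s lam Lam ρ)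

/-- Parabolic distance `d((x,t),(y,τ)) = max{|x-y|, |t-τ|^{1/(2s)}}`. -/
def parDist (d : ℕ) (s : ℝ) (p q : Ed d × ℝ) : ℝ :=
  max ‖p.1 - q.1‖ (|p.2 - q.2| ^ (1 / (2 * s)))

/-- The function `v` that equals the test function `φ` on the test cylinder
`B_ε(x₀) × (t₀-ε, t₀]` and `u` elsewhere. -/
def patchFn (d : ℕ) (u φ : Ed d → ℝ → ℝ) (x₀ : Ed d) (t₀ ε : ℝ) : Ed d → ℝ → ℝ :=
  fun x t => if x ∈ ball x₀ ε ∧ t ∈ Ioc (t₀ - ε) t₀ then φ x t else u x t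

/-- `φ` is an admissible (parabolic) test function on the cylinder `B_ε(x₀) × (t₀-ε, t₀]`:
`C^{1,1}` in space and left-differentiable in time. -/
def IsTestFn (d : ℕ) (φ : Ed d → ℝ → ℝ) (x₀ : Ed d) (t₀ ε : ℝ) : Prop :=
  (∀ t ∈ Ioc (t₀ - ε) t₀, ∀ x ∈ ball x₀ ε, DifferentiableAt ℝ (fun z => φ z t) x) ∧
  (∀ t ∈ Ioc (t₀ - ε) t₀, ∃ L : NNReal,
    LipschitzOnWith L (fun x => fderiv ℝ (fun z => φ z t) x) (ball x₀ ε)) ∧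
  (∀ x ∈ ball x₀ ε, ∀ t ∈ Ioc (t₀ - ε) t₀,
    ∃ D : ℝ, HasDerivWithinAt (fun τ => φ x τ) D (Iic t) t)

/-- Viscosity supersolution of `∂ₜ u + drift·|∇u| − M u ≥ f` in `Ω × I`. -/
def IsViscSuper (d : ℕ) (drift : ℝ) (M : (Ed d → ℝ) → Ed d → ℝ)
    (f : Ed d → ℝ → ℝ) (Ω : Set (Ed d)) (I : Set ℝ) (u : Ed d → ℝ → ℝ) : Prop :=
  LowerSemicontinuousOn (fun p : Ed d × ℝ => u p.1 p.2) (Ω ×ˢ I) ∧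
  ∀ x₀ ∈ Ω, ∀ t₀ ∈ I, ∀ ε : ℝ, 0 < ε → ball x₀ ε ⊆ Ω → Ioc (t₀ - ε) t₀ ⊆ I →
    ∀ φ : Ed d → ℝ → ℝ, IsTestFn d φ x₀ t₀ ε → φ x₀ t₀ = u x₀ t₀ →
      (∀ x ∈ ball x₀ ε, ∀ t ∈ Ioc (t₀ - ε) t₀, φ x t ≤ u x t) →
      f x₀ t₀ ≤
        derivWithin (patchFn d u φ x₀ t₀ ε x₀) (Iic t₀) t₀
          + drift * ‖fderiv ℝ (fun z => patchFn d u φ x₀ t₀ ε z t₀) x₀‖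
          - M (fun z => patchFn d u φ x₀ t₀ ε z t₀) x₀

/-- Viscosity subsolution of `∂ₜ u − drift·|∇u| − M u ≤ f` in `Ω × I`. -/
def IsViscSub (d : ℕ) (drift : ℝ) (M : (Ed d → ℝ) → Ed d → ℝ)
    (f : Ed d → ℝ → ℝ) (Ω : Set (Ed d)) (I : Set ℝ) (u : Ed d → ℝ → ℝ) : Prop :=
  UpperSemicontinuousOn (fun p : Ed d × ℝ => u p.1 p.2) (Ω ×ˢ I) ∧
  ∀ x₀ ∈ Ω, ∀ t₀ ∈ I, ∀ ε : ℝ, 0 < ε → ball x₀ ε ⊆ Ω → Ioc (t₀ - ε) t₀ ⊆ I →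
    ∀ φ : Ed d → ℝ → ℝ, IsTestFn d φ x₀ t₀ ε → φ x₀ t₀ = u x₀ t₀ →
      (∀ x ∈ ball x₀ ε, ∀ t ∈ Ioc (t₀ - ε) t₀, u x t ≤ φ x t) →
      derivWithin (patchFn d u φ x₀ t₀ ε x₀) (Iic t₀) t₀
          - drift * ‖fderiv ℝ (fun z => patchFn d u φ x₀ t₀ ε z t₀) x₀‖
          - M (fun z => patchFn d u φ x₀ t₀ ε z t₀) x₀ ≤ f x₀ t₀

/-- The class `S_ρ` of symmetric, integrable admissible kernels. -/
def SymClass (d : ℕ) (s lam Lam ρ : ℝ) : Set (Ed d → ℝ) :=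
  {K | K ∈ KernelClass d s lam Lam ρ ∧ Integrable K ∧ ∀ᵐ y, K y = K (-y)}

theorem exists_half_pow_near {x : ℝ} (hx0 : 0 < x) (hx1 : x < 1) :
    ∃ n : ℕ, (1 / 2 : ℝ) ^ (n + 1) ≤ x ∧ x < (1 / 2) ^ n := by
  obtain ⟨n, hn1, hn2⟩ := exists_nat_pow_near_of_lt_one hx0 hx1.le
    (show (0 : ℝ) < 1 / 2 by norm_num) (by norm_num)
  rcases hn2.lt_or_eq with h | h
  · exact ⟨n, hn1.le, h⟩
  · obtain _ | n := n
    · simp at h; linarith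
    · exact ⟨n, h.ge, h ▸ pow_lt_pow_right_of_lt_one₀ (by norm_num) (by norm_num) n.lt_succ_self⟩

/-- Dyadic bound for the integral of a weight against a kernel whose mass on dyadic annuli is
controlled. -/
theorem lintegral_annuli_le {d : ℕ} {s Lam : ℝ} {K : Ed d → ℝ} (hK0 : ∀ y, 0 ≤ K y)
    (hK : ∀ r : ℝ, 0 < r →
      ∫⁻ y in ball (0 : Ed d) (2 * r) \ ball 0 r, ENNReal.ofReal (K y) ≤
        ENNReal.ofReal (Lam * r ^ (-(2 * s))))
    {t a : ℕ → ℝ} (ht : ∀ k, 0 < t k) (ha : ∀ k, 0 ≤ a k) (hLam : 0 ≤ Lam)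
    {S : Set (Ed d)} (hS : S ⊆ ⋃ k, ball (0 : Ed d) (2 * t k) \ ball 0 (t k))
    {F : Ed d → ℝ} (hF : ∀ k, ∀ y ∈ ball (0 : Ed d) (2 * t k) \ ball 0 (t k), F y ≤ a k)
    {B : ℝ} (hB : HasSum (fun k => a k * (Lam * t k ^ (-(2 * s)))) B) :
    ∫⁻ y in S, ENNReal.ofReal (F y * K y) ≤ ENNReal.ofReal B := by
  have hnn : ∀ k, 0 ≤ a k * (Lam * t k ^ (-(2 * s))) := fun k =>
    mul_nonneg (ha k) (mul_nonneg hLam (Real.rpow_nonneg (ht k).le _))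
  calc ∫⁻ y in S, ENNReal.ofReal (F y * K y)
      ≤ ∫⁻ y in ⋃ k, ball (0 : Ed d) (2 * t k) \ ball 0 (t k), ENNReal.ofReal (F y * K y) :=
        lintegral_mono_set hS
    _ ≤ ∑' k, ∫⁻ y in ball (0 : Ed d) (2 * t k) \ ball 0 (t k), ENNReal.ofReal (F y * K y) :=
        lintegral_iUnion_le _ _
    _ ≤ ∑' k, ENNReal.ofReal (a k * (Lam * t k ^ (-(2 * s)))) := by
        refine ENNReal.tsum_le_tsum fun k => ?_
        calc ∫⁻ y in ball (0 : Ed d) (2 * t k) \ ball 0 (t k), ENNReal.ofReal (F y * K y)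
            ≤ ∫⁻ y in ball (0 : Ed d) (2 * t k) \ ball 0 (t k),
                ENNReal.ofReal (a k) * ENNReal.ofReal (K y) := by
              refine setLIntegral_mono' (measurableSet_ball.diff measurableSet_ball) fun y hy => ?_
              rw [← ENNReal.ofReal_mul (ha k)]
              exact ENNReal.ofReal_le_ofReal (mul_le_mul_of_nonneg_right (hF k y hy) (hK0 y))
          _ = ENNReal.ofReal (a k) * ∫⁻ y in ball (0 : Ed d) (2 * t k) \ ball 0 (t k),
                ENNReal.ofReal (K y) := lintegral_const_mul' _ _ ENNReal.ofReal_ne_top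
          _ ≤ ENNReal.ofReal (a k) * ENNReal.ofReal (Lam * t k ^ (-(2 * s))) := by
              gcongr; exact hK _ (ht k)
          _ = _ := (ENNReal.ofReal_mul (ha k)).symm
    _ = ENNReal.ofReal B := by
        rw [← ENNReal.ofReal_tsum_of_nonneg hnn hB.summable, hB.tsum_eq]

/-- Second moment of the kernel near the origin. -/
theorem lintegral_sq_mul_kernel_le {d : ℕ} {s Lam : ℝ} (hs : s ∈ Ioo (0 : ℝ) 1) (hLam : 0 ≤ Lam)
    {K : Ed d → ℝ} (hK0 : ∀ y, 0 ≤ K y)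
    (hK : ∀ r : ℝ, 0 < r →
      ∫⁻ y in ball (0 : Ed d) (2 * r) \ ball 0 r, ENNReal.ofReal (K y) ≤
        ENNReal.ofReal (Lam * r ^ (-(2 * s)))) {r : ℝ} (hr : 0 < r) :
    ∫⁻ y in ball (0 : Ed d) r \ {0}, ENNReal.ofReal ((‖y‖ / r) ^ 2 * K y) ≤
      ENNReal.ofReal (Lam * r ^ (-(2 * s)) * (2 ^ (2 * s) / (1 - 2 ^ (2 * s - 2)))) := by
  have h2 : (2 : ℝ) ^ (2 * s - 2) < 1 :=
    Real.rpow_lt_one_of_one_lt_of_neg (by norm_num) (by linarith [hs.2])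
  refine lintegral_annuli_le hK0 hK (t := fun k => r * (1 / 2) ^ (k + 1))
    (a := fun k => ((1 / 2) ^ k) ^ 2) (fun k => by positivity) (fun k => by positivity) hLam
    ?_ ?_ ?_
  · rintro y ⟨hy, hy0⟩
    rw [mem_ball_zero_iff] at hy
    have hy0' : 0 < ‖y‖ := norm_pos_iff.2 hy0
    have hx0 : 0 < ‖y‖ / r := by positivity
    have hx1 : ‖y‖ / r < 1 := (div_lt_one hr).2 hy
    obtain ⟨n, h1, h2⟩ := exists_half_pow_near hx0 hx1
    rw [le_div_iff₀ hr] at h1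
    rw [div_lt_iff₀ hr] at h2
    refine mem_iUnion.2 ⟨n, ?_, ?_⟩
    · rw [mem_ball_zero_iff, pow_succ]; linarith
    · rw [mem_ball_zero_iff, not_lt]; linarith
  · rintro k y ⟨hy, -⟩
    rw [mem_ball_zero_iff, pow_succ] at hy
    have : ‖y‖ / r ≤ (1 / 2) ^ k := by rw [div_le_iff₀ hr]; linarith
    gcongr
  · have hsum := (hasSum_geometric_of_lt_one (r := (2 : ℝ) ^ (2 * s - 2)) (by positivity) h2).mul_left
      (Lam * r ^ (-(2 * s)) * 2 ^ (2 * s))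
    rw [show Lam * r ^ (-(2 * s)) * (2 ^ (2 * s) / (1 - 2 ^ (2 * s - 2))) =
        Lam * r ^ (-(2 * s)) * 2 ^ (2 * s) * (1 - 2 ^ (2 * s - 2))⁻¹ by
      rw [div_eq_mul_inv]; ring]
    refine Eq.mpr (congrArg (fun f => HasSum f _) (funext fun k => ?_)) hsum
    · have e : ∀ n : ℕ, (1 / 2 : ℝ) ^ n = 2 ^ (-(n : ℝ)) := fun n => by
        rw [Real.rpow_neg (by norm_num), Real.rpow_natCast, one_div, inv_pow]
      rw [Real.mul_rpow hr.le (by positivity), e, e, ← Real.rpow_mul (by norm_num),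
        ← Real.rpow_natCast (2 ^ (-(k : ℝ))), ← Real.rpow_mul (by norm_num),
        ← Real.rpow_natCast (2 ^ (2 * s - 2)), ← Real.rpow_mul (by norm_num)]
      have : (2 : ℝ) ^ (-(k : ℝ) * (2 : ℕ)) * 2 ^ (-((k + 1 : ℕ) : ℝ) * -(2 * s)) =
          2 ^ (2 * s) * 2 ^ ((2 * s - 2) * k) := by
        rw [← Real.rpow_add (by norm_num), ← Real.rpow_add (by norm_num)]
        congr 1; push_cast; ring
      linear_combination (Lam * r ^ (-(2 * s))) * this

/-- Tail of the kernel against a slowly growing weight. -/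
theorem lintegral_tail_mul_kernel_le {d : ℕ} {s Lam α κ : ℝ} (hs : 0 < s) (hLam : 0 ≤ Lam)
    (hα : 0 < α) (hαs : α < 2 * s) (hκ : 0 ≤ κ) {K : Ed d → ℝ} (hK0 : ∀ y, 0 ≤ K y)
    (hK : ∀ r : ℝ, 0 < r →
      ∫⁻ y in ball (0 : Ed d) (2 * r) \ ball 0 r, ENNReal.ofReal (K y) ≤
        ENNReal.ofReal (Lam * r ^ (-(2 * s)))) {r : ℝ} (hr : 0 < r) :
    ∫⁻ y in (ball (0 : Ed d) (r / 4))ᶜ,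
        ENNReal.ofReal (((8 * ‖y‖ / r) ^ α - 2 ^ (-α) + κ) * K y) ≤
      ENNReal.ofReal (Lam * r ^ (-(2 * s)) * (4 ^ (2 * s) *
        (4 ^ α / (1 - 2 ^ (α - 2 * s)) + (κ - 2 ^ (-α)) / (1 - 2 ^ (-(2 * s)))))) := by
  have h1 : (2 : ℝ) ^ (α - 2 * s) < 1 :=
    Real.rpow_lt_one_of_one_lt_of_neg (by norm_num) (by linarith)
  have h2 : (2 : ℝ) ^ (-(2 * s)) < 1 :=
    Real.rpow_lt_one_of_one_lt_of_neg (by norm_num) (by linarith)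
  have h3 : (2 : ℝ) ^ (-α) ≤ 1 :=
    Real.rpow_le_one_of_one_le_of_nonpos (by norm_num) (by linarith)
  refine lintegral_annuli_le hK0 hK (t := fun k => r / 4 * 2 ^ k)
    (a := fun k => (4 * 2 ^ k) ^ α - 2 ^ (-α) + κ) (fun k => by positivity) (fun k => ?_) hLam
    ?_ ?_ ?_
  · have h4 : (1 : ℝ) ≤ (4 * 2 ^ k) ^ α := by
      refine Real.one_le_rpow ?_ hα.le
      have : (1 : ℝ) ≤ 2 ^ k := one_le_pow₀ (by norm_num)
      linarith
    show 0 ≤ (4 * 2 ^ k : ℝ) ^ α - 2 ^ (-α) + κ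
    linarith
  · intro y hy
    rw [mem_compl_iff, mem_ball_zero_iff, not_lt] at hy
    obtain ⟨n, hn1, hn2⟩ := exists_nat_pow_near (x := ‖y‖ / (r / 4)) (y := 2)
      ((one_le_div (by positivity)).2 hy) (by norm_num)
    rw [le_div_iff₀ (by positivity)] at hn1
    rw [div_lt_iff₀ (by positivity), pow_succ] at hn2
    refine mem_iUnion.2 ⟨n, ?_, ?_⟩
    · rw [mem_ball_zero_iff]; linarith
    · rw [mem_ball_zero_iff, not_lt]; linarith
  · rintro k y ⟨hy, -⟩
    rw [mem_ball_zero_iff] at hy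
    have : 8 * ‖y‖ / r ≤ 4 * 2 ^ k := by rw [div_le_iff₀ hr]; linarith
    show _ ≤ (4 * 2 ^ k : ℝ) ^ α - 2 ^ (-α) + κ
    gcongr
  · have hA := (hasSum_geometric_of_lt_one (r := (2 : ℝ) ^ (α - 2 * s)) (by positivity) h1).mul_left
      (Lam * r ^ (-(2 * s)) * 4 ^ (2 * s) * 4 ^ α)
    have hB := (hasSum_geometric_of_lt_one (r := (2 : ℝ) ^ (-(2 * s))) (by positivity) h2).mul_left
      (Lam * r ^ (-(2 * s)) * 4 ^ (2 * s) * (κ - 2 ^ (-α)))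
    have hAB := hA.add hB
    rw [show Lam * r ^ (-(2 * s)) * (4 ^ (2 * s) *
        (4 ^ α / (1 - 2 ^ (α - 2 * s)) + (κ - 2 ^ (-α)) / (1 - 2 ^ (-(2 * s))))) =
        Lam * r ^ (-(2 * s)) * 4 ^ (2 * s) * 4 ^ α * (1 - 2 ^ (α - 2 * s))⁻¹ +
        Lam * r ^ (-(2 * s)) * 4 ^ (2 * s) * (κ - 2 ^ (-α)) * (1 - 2 ^ (-(2 * s)))⁻¹ by
      simp only [div_eq_mul_inv]; ring]
    refine Eq.mpr (congrArg (fun f => HasSum f _) (funext fun k => ?_)) hAB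
    · have e1 : ((2 : ℝ) ^ (α - 2 * s)) ^ k = (2 ^ k) ^ α * (2 ^ k) ^ (-(2 * s)) := by
        rw [sub_eq_add_neg, Real.rpow_add (by norm_num), mul_pow, ← Real.rpow_natCast,
          ← Real.rpow_natCast, ← Real.rpow_natCast, ← Real.rpow_mul (by norm_num),
          ← Real.rpow_mul (by norm_num), ← Real.rpow_mul (by norm_num),
          ← Real.rpow_mul (by norm_num)]
        ring_nf
      have e2 : ((2 : ℝ) ^ (-(2 * s))) ^ k = (2 ^ k) ^ (-(2 * s)) := by
        rw [← Real.rpow_natCast, ← Real.rpow_natCast, ← Real.rpow_mul (by norm_num),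
          ← Real.rpow_mul (by norm_num)]
        ring_nf
      have e3 : (r / 4 * 2 ^ k) ^ (-(2 * s)) =
          r ^ (-(2 * s)) * 4 ^ (2 * s) * (2 ^ k) ^ (-(2 * s)) := by
        rw [Real.mul_rpow (by positivity) (by positivity), Real.div_rpow hr.le (by norm_num),
          Real.rpow_neg (show (0 : ℝ) ≤ 4 by norm_num), div_inv_eq_mul]
      rw [e1, e2, e3, Real.mul_rpow (by norm_num) (by positivity)]
      ring

/-- Lower bound for the mass that an elliptic kernel puts on a set of positive density. -/
theorem le_integral_kernel {d : ℕ} (hd : 1 ≤ d) {s lam Lam ρ r : ℝ} (hs : 0 < s)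
    (hlam : 0 ≤ lam) (hρ : 0 < ρ) (hρr : ρ ≤ r) {K : Ed d → ℝ}
    (hK : K ∈ SymClass d s lam Lam ρ) {G : Set (Ed d)} (hG : MeasurableSet G)
    (hGr : G ⊆ ball 0 (2 * r)) (hGv : ENNReal.ofReal (r ^ d) * volume (ball (0 : Ed d) 1) / 2 ≤ volume G) :
    lam * 2 ^ (-(d : ℝ) - 2 * s) * (volume (ball (0 : Ed d) 1)).toReal / 2 * r ^ (-(2 * s)) ≤
      ∫ y in G, K y := by
  have hr : 0 < r := hρ.trans_le hρr
  have : Nonempty (Fin d) := ⟨⟨0, hd⟩⟩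
  have hGfin : volume G ≠ ⊤ := ((measure_mono hGr).trans_lt measure_ball_lt_top).ne
  have h1 : ∫ y in G, lam * (2 * r) ^ (-(d : ℝ) - 2 * s) ≤ ∫ y in G, K y := by
    refine integral_mono_ae (integrableOn_const hGfin) hK.2.1.integrableOn ?_
    have h0 : ∀ᵐ y : Ed d ∂volume.restrict G, y ≠ 0 :=
      ae_restrict_of_ae (Measure.ae_ne volume 0)
    filter_upwards [h0, ae_restrict_mem hG] with y hy hyG
    refine le_trans ?_ (hK.1.2.2.1 y hy)
    have hy2 := mem_ball_zero_iff.1 (hGr hyG)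
    rw [truncKer, if_neg hρ.ne']
    refine mul_le_mul_of_nonneg_left (le_min ?_ ?_) hlam
    · exact Real.rpow_le_rpow_of_nonpos (norm_pos_iff.2 hy) hy2.le
        (by have : (0 : ℝ) ≤ d := d.cast_nonneg; linarith)
    · exact Real.rpow_le_rpow_of_nonpos hρ (by linarith)
        (by have : (0 : ℝ) ≤ d := d.cast_nonneg; linarith)
  refine le_trans ?_ h1
  rw [setIntegral_const, smul_eq_mul]
  have h2 : r ^ d * (volume (ball (0 : Ed d) 1)).toReal / 2 ≤ volume.real G := by
    have := ENNReal.toReal_mono hGfin hGv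
    rwa [ENNReal.toReal_div, ENNReal.toReal_mul, ENNReal.toReal_ofReal (by positivity)] at this
  have h3 : r ^ d * (2 * r) ^ (-(d : ℝ) - 2 * s) =
      2 ^ (-(d : ℝ) - 2 * s) * r ^ (-(2 * s)) := by
    rw [Real.mul_rpow (by norm_num) hr.le, ← Real.rpow_natCast]
    rw [show (-(2 * s)) = (d : ℝ) + (-(d : ℝ) - 2 * s) by ring, Real.rpow_add hr d]
    ring
  calc _ = (r ^ d * (volume (ball (0 : Ed d) 1)).toReal / 2) *
        (lam * (2 * r) ^ (-(d : ℝ) - 2 * s)) := by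
        linear_combination (-(lam * (volume (ball (0 : Ed d) 1)).toReal / 2)) * h3
    _ ≤ _ := by gcongr

/-- Choice of the bump height `κ` and of the Hölder exponent `α`. -/
theorem exists_bump_exponent {s Lam c : ℝ} (hs : 0 < s) (hc : 0 < c) (C₁ : ℝ) :
    ∃ κ α : ℝ, 0 < κ ∧ κ ≤ 1 / 16 ∧ 0 < α ∧ α < 2 * s ∧ 1 - κ / 4 ≤ 2 ^ (-α) ∧
      Lam * (2 * κ * C₁ + 2 * (4 ^ (2 * s) *
        (4 ^ α / (1 - 2 ^ (α - 2 * s)) + (2 * κ - 2 ^ (-α)) / (1 - 2 ^ (-(2 * s)))))) ≤ c := by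
  have hq : (2 : ℝ) ^ (-(2 * s)) < 1 :=
    Real.rpow_lt_one_of_one_lt_of_neg (by norm_num) (by linarith)
  let g : ℝ → ℝ → ℝ := fun κ α => Lam * (2 * κ * C₁ + 2 * (4 ^ (2 * s) *
    (4 ^ α / (1 - 2 ^ (α - 2 * s)) + (2 * κ - 2 ^ (-α)) / (1 - 2 ^ (-(2 * s))))))
  have hg0 : g 0 0 = 0 := by
    simp only [g, Real.rpow_zero, neg_zero, zero_sub, mul_zero, zero_mul, zero_add]
    rw [← add_div]; simp
  have hgκ : ContinuousAt (fun κ => g κ 0) 0 := by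
    simp only [g]; fun_prop
  have e1 : ∀ᶠ κ in nhdsWithin (0 : ℝ) (Ioi 0), g κ 0 < c :=
    (hgκ.eventually_lt continuousAt_const (by simpa [hg0] using hc)).filter_mono nhdsWithin_le_nhds
  have e2 : ∀ᶠ κ in nhdsWithin (0 : ℝ) (Ioi 0), κ < 1 / 16 :=
    (eventually_lt_nhds (by norm_num)).filter_mono nhdsWithin_le_nhds
  obtain ⟨κ, ⟨hκ1, hκ2⟩, hκ⟩ := ((e1.and e2).and self_mem_nhdsWithin).exists
  have hκ : 0 < κ := hκ
  have hgα : ContinuousAt (fun α => g κ α) 0 := by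
    have h1 : ContinuousAt (fun α : ℝ => (4 : ℝ) ^ α) 0 :=
      Real.continuousAt_const_rpow (by norm_num)
    have h2 : ContinuousAt (fun α : ℝ => (2 : ℝ) ^ (α - 2 * s)) 0 :=
      (Real.continuous_const_rpow (by norm_num)).continuousAt.comp (by fun_prop)
    have h3 : ContinuousAt (fun α : ℝ => (2 : ℝ) ^ (-α)) 0 :=
      (Real.continuous_const_rpow (by norm_num)).continuousAt.comp (by fun_prop)
    have h4 : ContinuousAt (fun α : ℝ => (4 : ℝ) ^ α / (1 - 2 ^ (α - 2 * s))) 0 :=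
      h1.div (continuousAt_const.sub h2) (by rw [zero_sub]; linarith)
    have h5 : ContinuousAt (fun α : ℝ => (2 * κ - (2 : ℝ) ^ (-α)) / (1 - 2 ^ (-(2 * s)))) 0 :=
      (continuousAt_const.sub h3).div_const _
    exact continuousAt_const.mul (continuousAt_const.add (continuousAt_const.mul
      (continuousAt_const.mul (h4.add h5))))
  have hpow : ContinuousAt (fun α : ℝ => (2 : ℝ) ^ (-α)) 0 :=
    (Real.continuous_const_rpow (by norm_num)).continuousAt.comp (by fun_prop)
  have e3 : ∀ᶠ α in nhdsWithin (0 : ℝ) (Ioi 0), g κ α < c :=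
    (hgα.eventually_lt continuousAt_const hκ1).filter_mono nhdsWithin_le_nhds
  have e4 : ∀ᶠ α in nhdsWithin (0 : ℝ) (Ioi 0), 1 - κ / 4 < (2 : ℝ) ^ (-α) :=
    (continuousAt_const.eventually_lt hpow (by simp [hκ])).filter_mono nhdsWithin_le_nhds
  have e5 : ∀ᶠ α in nhdsWithin (0 : ℝ) (Ioi 0), α < 2 * s :=
    (eventually_lt_nhds (by linarith)).filter_mono nhdsWithin_le_nhds
  obtain ⟨α, ⟨⟨h3, h4⟩, h5⟩, hα⟩ := (((e3.and e4).and e5).and self_mem_nhdsWithin).exists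
  exact ⟨κ, α, hκ, hκ2.le, hα, h5, h4.le, h3.le⟩

theorem integrableOn_and_setIntegral_le {d : ℕ} {S : Set (Ed d)} (hS : MeasurableSet S)
    {h : Ed d → ℝ} (hm : Measurable h) (h0 : ∀ y ∈ S, 0 ≤ h y) {B : ℝ} (hB0 : 0 ≤ B)
    (hB : ∫⁻ y in S, ENNReal.ofReal (h y) ≤ ENNReal.ofReal B) :
    IntegrableOn h S ∧ ∫ y in S, h y ≤ B := by
  have h0' : 0 ≤ᵐ[volume.restrict S] h := by
    filter_upwards [ae_restrict_mem hS] with y hy using h0 y hy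
  refine ⟨(lintegral_ofReal_ne_top_iff_integrable hm.aestronglyMeasurable h0').1
    (ne_top_of_le_ne_top ENNReal.ofReal_ne_top hB), ?_⟩
  rw [integral_eq_lintegral_of_nonneg_ae h0' hm.aestronglyMeasurable]
  exact ENNReal.toReal_le_of_le_ofReal hB0 hB

/-- Integrated form of the growth lemma: a function whose second increments at `p` are bounded by
a small convex part, a small tail, and a definite negative amount on a set of positive density
violates the differential inequality. -/
theorem integral_incr_le {d : ℕ} (hd : 1 ≤ d) {s lam Lam ρ r α κ c H : ℝ}
    (hs : s ∈ Ioo (0 : ℝ) 1) (hlam : 0 ≤ lam) (hLam : 0 ≤ Lam) (hρ : 0 < ρ) (hρr : ρ ≤ r)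
    (hα : 0 < α) (hαs : α < 2 * s) (hκ : 0 ≤ κ) (hH : 0 ≤ H)
    (hc : c = lam * 2 ^ (-(d : ℝ) - 2 * s) * (volume (ball (0 : Ed d) 1)).toReal / 2)
    (hconst : Lam * (2 * κ * (2 ^ (2 * s) / (1 - 2 ^ (2 * s - 2))) + 2 * (4 ^ (2 * s) *
      (4 ^ α / (1 - 2 ^ (α - 2 * s)) + (2 * κ - 2 ^ (-α)) / (1 - 2 ^ (-(2 * s)))))) ≤ c / 16)
    {K : Ed d → ℝ} (hK : K ∈ SymClass d s lam Lam ρ) {D : Ed d → ℝ} (hDm : Measurable D)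
    (hDb : ∃ b, ∀ y, |D y| ≤ b) {G : Set (Ed d)} (hG : MeasurableSet G)
    (hGr : G ⊆ ball 0 (2 * r))
    (hGv : ENNReal.ofReal (r ^ d) * volume (ball (0 : Ed d) 1) / 2 ≤ volume G)
    (hD : ∀ y, D y ≤
      2 * κ * H * (ball (0 : Ed d) r \ {0}).indicator (fun y => (‖y‖ / r) ^ 2) y +
      2 * H * (ball (0 : Ed d) (r / 4))ᶜ.indicator
        (fun y => (8 * ‖y‖ / r) ^ α - 2 ^ (-α) + 2 * κ) y -
      H / 8 * G.indicator (fun _ => 1) y) :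
    ∫ y, D y * K y ≤ -(c / 16) * (H * r ^ (-(2 * s))) := by
  have hr : 0 < r := hρ.trans_le hρr
  have hKm := hK.1.1
  have hK0 := hK.1.2.1
  have hKa := hK.1.2.2.2.1
  have h3 : (2 : ℝ) ^ (-α) ≤ 1 :=
    Real.rpow_le_one_of_one_le_of_nonpos (by norm_num) (by linarith)
  have q1 : (2 : ℝ) ^ (2 * s - 2) < 1 :=
    Real.rpow_lt_one_of_one_lt_of_neg (by norm_num) (by linarith [hs.2])
  have q2 : (2 : ℝ) ^ (α - 2 * s) < 1 :=
    Real.rpow_lt_one_of_one_lt_of_neg (by norm_num) (by linarith)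
  have q3 : (2 : ℝ) ^ (-(2 * s)) < 1 :=
    Real.rpow_lt_one_of_one_lt_of_neg (by norm_num) (by linarith [hs.1])
  have hS1 : MeasurableSet (ball (0 : Ed d) r \ {0}) :=
    measurableSet_ball.diff (measurableSet_singleton 0)
  have hS2 : MeasurableSet (ball (0 : Ed d) (r / 4))ᶜ := measurableSet_ball.compl
  have htail0 : ∀ y ∈ (ball (0 : Ed d) (r / 4))ᶜ,
      0 ≤ (8 * ‖y‖ / r) ^ α - 2 ^ (-α) + 2 * κ := by
    intro y hy
    rw [mem_compl_iff, mem_ball_zero_iff, not_lt] at hy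
    have : (1 : ℝ) ≤ (8 * ‖y‖ / r) ^ α :=
      Real.one_le_rpow ((one_le_div hr).2 (by linarith)) hα.le
    linarith
  have hB2 : (0 : ℝ) ≤ 4 ^ α / (1 - 2 ^ (α - 2 * s)) +
      (2 * κ - 2 ^ (-α)) / (1 - 2 ^ (-(2 * s))) := by
    have a1 : (1 : ℝ) / (1 - 2 ^ (-(2 * s))) ≤ 4 ^ α / (1 - 2 ^ (α - 2 * s)) := by
      have : (2 : ℝ) ^ (-(2 * s)) ≤ 2 ^ (α - 2 * s) :=
        Real.rpow_le_rpow_of_exponent_le (by norm_num) (by linarith)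
      exact div_le_div₀ (by positivity) (Real.one_le_rpow (by norm_num) hα.le) (by linarith)
        (by linarith)
    have a2 : -1 / (1 - (2 : ℝ) ^ (-(2 * s))) ≤ (2 * κ - 2 ^ (-α)) / (1 - 2 ^ (-(2 * s))) :=
      div_le_div_of_nonneg_right (by linarith) (by linarith)
    rw [neg_div] at a2
    linarith
  obtain ⟨I1, J1⟩ := integrableOn_and_setIntegral_le hS1
    (h := fun y => (‖y‖ / r) ^ 2 * K y) (by fun_prop)
    (fun y _ => mul_nonneg (by positivity) (hK0 y))
    (mul_nonneg (mul_nonneg hLam (by positivity)) (div_nonneg (by positivity) (by linarith)))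
    (lintegral_sq_mul_kernel_le hs hLam hK0 hKa hr)
  obtain ⟨I2, J2⟩ := integrableOn_and_setIntegral_le hS2
    (h := fun y => ((8 * ‖y‖ / r) ^ α - 2 ^ (-α) + 2 * κ) * K y) (by fun_prop)
    (fun y hy => mul_nonneg (htail0 y hy) (hK0 y))
    (mul_nonneg (mul_nonneg hLam (by positivity)) (mul_nonneg (by positivity) hB2))
    (lintegral_tail_mul_kernel_le hs.1 hLam hα hαs (by positivity) hK0 hKa hr)
  have I3 : IntegrableOn K G := hK.2.1.integrableOn
  have J3 := le_integral_kernel hd hs.1 hlam hρ hρr hK hG hGr hGv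
  rw [← hc] at J3
  obtain ⟨b, hb⟩ := hDb
  have I0 : Integrable (fun y => D y * K y) :=
    hK.2.1.bdd_mul hDm.aestronglyMeasurable (c := b) (Filter.Eventually.of_forall hb)
  have I1' := ((integrable_indicator_iff hS1).2 I1).const_mul (2 * κ * H)
  have I2' := ((integrable_indicator_iff hS2).2 I2).const_mul (2 * H)
  have I3' := ((integrable_indicator_iff hG).2 I3).const_mul (H / 8)
  have I12 : Integrable (fun y =>
      2 * κ * H * (ball (0 : Ed d) r \ {0}).indicator (fun y => (‖y‖ / r) ^ 2 * K y) y +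
        2 * H * (ball (0 : Ed d) (r / 4))ᶜ.indicator
          (fun y => ((8 * ‖y‖ / r) ^ α - 2 ^ (-α) + 2 * κ) * K y) y) := I1'.add I2'
  have hle : ∫ y, D y * K y ≤ ∫ y,
      ((2 * κ * H * (ball (0 : Ed d) r \ {0}).indicator (fun y => (‖y‖ / r) ^ 2 * K y) y +
        2 * H * (ball (0 : Ed d) (r / 4))ᶜ.indicator
          (fun y => ((8 * ‖y‖ / r) ^ α - 2 ^ (-α) + 2 * κ) * K y) y) -
        H / 8 * G.indicator K y) := by
    refine integral_mono I0 (I12.sub I3') fun y => ?_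
    refine (mul_le_mul_of_nonneg_right (hD y) (hK0 y)).trans_eq ?_
    by_cases m1 : y ∈ ball (0 : Ed d) r \ {0} <;> by_cases m2 : y ∈ (ball (0 : Ed d) (r / 4))ᶜ <;>
      by_cases m3 : y ∈ G <;>
      simp only [indicator_of_mem, indicator_of_notMem, m1, m2, m3, not_false_eq_true] <;> ring
  rw [integral_sub I12 I3', integral_add I1' I2', integral_const_mul,
    integral_const_mul, integral_const_mul, integral_indicator hS1, integral_indicator hS2,
    integral_indicator hG] at hle
  have k1 := mul_le_mul_of_nonneg_left J1 (show 0 ≤ 2 * κ * H by positivity)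
  have k2 := mul_le_mul_of_nonneg_left J2 (show 0 ≤ 2 * H by positivity)
  have k3 := mul_le_mul_of_nonneg_left J3 (show 0 ≤ H / 8 by positivity)
  have k4 := mul_le_mul_of_nonneg_right hconst (show 0 ≤ H * r ^ (-(2 * s)) by positivity)
  linarith

/-- Growth lemma: a bounded subsolution below `M` in a ball, with controlled growth outside, and
which is well below `M` on half of the ball, is strictly below `M` in the half ball. -/
theorem le_sub_of_subsolution {d : ℕ} (hd : 1 ≤ d) {s lam Lam ρ r α κ c H M A : ℝ} {x₀ : Ed d}
    (hs : s ∈ Ioo (0 : ℝ) 1) (hlam : 0 ≤ lam) (hLam : 0 ≤ Lam) (hρ : 0 < ρ) (hρr : ρ ≤ r)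
    (hα : 0 < α) (hαs : α < 2 * s) (hκ : 0 < κ) (hκ' : κ ≤ 1 / 16) (hH : 0 < H)
    (hc : c = lam * 2 ^ (-(d : ℝ) - 2 * s) * (volume (ball (0 : Ed d) 1)).toReal / 2)
    (hc0 : 0 < c)
    (hconst : Lam * (2 * κ * (2 ^ (2 * s) / (1 - 2 ^ (2 * s - 2))) + 2 * (4 ^ (2 * s) *
      (4 ^ α / (1 - 2 ^ (α - 2 * s)) + (2 * κ - 2 ^ (-α)) / (1 - 2 ^ (-(2 * s)))))) ≤ c / 16)
    {u : Ed d → ℝ} (hum : Measurable u) {b : ℝ} (hub : ∀ z, |u z| ≤ b)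
    (huc : ContinuousOn u (closedBall x₀ (3 * r / 4)))
    (hsub : ∀ x ∈ closedBall x₀ (3 * r / 4), ∀ ε : ℝ, 0 < ε → ∃ K ∈ SymClass d s lam Lam ρ,
      -A - ε < ∫ y, (u (x + y) + u (x - y) - 2 * u x) * K y)
    (hA : A ≤ c / 32 * (H * r ^ (-(2 * s))))
    (hin : ∀ z ∈ ball x₀ r, u z ≤ M)
    (hout : ∀ z ∉ ball x₀ r, u z ≤ M + H * ((2 * ‖z - x₀‖ / r) ^ α - 2 ^ (-α)))
    (hG : volume (ball x₀ r) / 2 ≤ volume (ball x₀ r ∩ {z | u z ≤ M - H / 4})) :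
    ∀ z ∈ ball x₀ (r / 2), u z ≤ M - κ / 4 * H := by
  intro z₁ hz₁
  by_contra! hlt
  have hr : 0 < r := hρ.trans_le hρr
  have : Nonempty (Fin d) := ⟨⟨0, hd⟩⟩
  have hκH : 0 < κ * H := mul_pos hκ hH
  set φ : Ed d → ℝ := fun z => κ * H * max 0 (1 - (‖z - x₀‖ / r) ^ 2) with hφ
  have hφ0 : ∀ z, 0 ≤ φ z := fun z => mul_nonneg hκH.le (le_max_left _ _)
  have hφ1 : ∀ z, φ z ≤ κ * H := fun z =>
    mul_le_of_le_one_right hκH.le (max_le zero_le_one (by linarith [sq_nonneg (‖z - x₀‖ / r)]))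
  have hφl : ∀ z, κ * H * (1 - (‖z - x₀‖ / r) ^ 2) ≤ φ z := fun z =>
    mul_le_mul_of_nonneg_left (le_max_right _ _) hκH.le
  have hφeq : ∀ z, ‖z - x₀‖ ≤ r → φ z = κ * H * (1 - (‖z - x₀‖ / r) ^ 2) := fun z hz => by
    have h1 : ‖z - x₀‖ / r ≤ 1 := (div_le_one hr).2 hz
    have h2 : 0 ≤ ‖z - x₀‖ / r := by positivity
    simp only [hφ]
    rw [max_eq_right (by nlinarith)]
  have hφz : ∀ z, r ≤ ‖z - x₀‖ → φ z = 0 := fun z hz => by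
    have h1 : 1 ≤ ‖z - x₀‖ / r := (one_le_div hr).2 hz
    simp only [hφ]
    rw [max_eq_left (by nlinarith), mul_zero]
  have hφc : Continuous φ := by simp only [hφ]; fun_prop
  have hz₁' : z₁ ∈ closedBall x₀ (3 * r / 4) := by
    rw [mem_ball] at hz₁; rw [mem_closedBall]; linarith
  obtain ⟨p, hp, hpmax⟩ := (isCompact_closedBall x₀ (3 * r / 4)).exists_isMaxOn ⟨z₁, hz₁'⟩
    (huc.add hφc.continuousOn)
  have hpr : ‖p - x₀‖ ≤ 3 * r / 4 := by rwa [mem_closedBall, dist_eq_norm] at hp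
  have hup : M + κ * H / 2 < u p + φ p := by
    have h1 : u z₁ + φ z₁ ≤ u p + φ p := hpmax hz₁'
    have h2 := hφl z₁
    have h3 : ‖z₁ - x₀‖ / r ≤ 1 / 2 := by
      rw [mem_ball, dist_eq_norm] at hz₁
      rw [div_le_iff₀ hr]; linarith
    have h4 : (‖z₁ - x₀‖ / r) ^ 2 ≤ (1 / 2) ^ 2 := by gcongr
    nlinarith
  have hmax : ∀ z ∈ ball x₀ r, u z + φ z ≤ u p + φ p := by
    intro z hz
    by_cases hz' : z ∈ closedBall x₀ (3 * r / 4)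
    · exact hpmax hz'
    · rw [mem_closedBall, not_le, dist_eq_norm] at hz'
      have hzr := hz
      rw [mem_ball, dist_eq_norm] at hzr
      have h3 : 3 / 4 ≤ ‖z - x₀‖ / r := by rw [le_div_iff₀ hr]; linarith
      have h4 : (3 / 4 : ℝ) ^ 2 ≤ (‖z - x₀‖ / r) ^ 2 := by gcongr
      have h5 := hφeq z hzr.le
      have h6 := hin z hz
      nlinarith
  have hupM : M - κ * H / 2 < u p := by linarith [hφ1 p]
  let T : Ed d → ℝ := (ball (0 : Ed d) (r / 4))ᶜ.indicator
    (fun y => (8 * ‖y‖ / r) ^ α - 2 ^ (-α) + κ)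
  have h2α : (2 : ℝ) ^ (-α) ≤ 1 :=
    Real.rpow_le_one_of_one_le_of_nonpos (by norm_num) (by linarith)
  have htail : ∀ y ∈ (ball (0 : Ed d) (r / 4))ᶜ, 0 ≤ (8 * ‖y‖ / r) ^ α - 2 ^ (-α) + κ := by
    intro y hy
    rw [mem_compl_iff, mem_ball_zero_iff, not_lt] at hy
    have : (1 : ℝ) ≤ (8 * ‖y‖ / r) ^ α :=
      Real.one_le_rpow ((one_le_div hr).2 (by linarith)) hα.le
    linarith
  have hT0 : ∀ y, 0 ≤ T y := fun y => indicator_nonneg htail y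
  have hTneg : ∀ y, T (-y) = T y := fun y => by simp [T, indicator]
  have hinc : ∀ y, u (p + y) - u p ≤ φ p - φ (p + y) + H * T y := by
    intro y
    by_cases hy : p + y ∈ ball x₀ r
    · have := hmax _ hy
      have := mul_nonneg hH.le (hT0 y)
      linarith
    · have h1 := hout _ hy
      rw [mem_ball, dist_eq_norm, not_lt] at hy
      have h2 : ‖p + y - x₀‖ ≤ ‖p - x₀‖ + ‖y‖ := by
        rw [show p + y - x₀ = p - x₀ + y by abel]; exact norm_add_le _ _
      have h3 : r / 4 ≤ ‖y‖ := by linarith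
      have h4 : y ∈ (ball (0 : Ed d) (r / 4))ᶜ := by
        rwa [mem_compl_iff, mem_ball_zero_iff, not_lt]
      have h5 : T y = (8 * ‖y‖ / r) ^ α - 2 ^ (-α) + κ := indicator_of_mem h4 _
      have h6 : (2 * ‖p + y - x₀‖ / r) ^ α ≤ (8 * ‖y‖ / r) ^ α := by
        have : 2 * ‖p + y - x₀‖ ≤ 8 * ‖y‖ := by linarith
        gcongr
      rw [h5, hφz _ hy]
      have h7 := mul_le_mul_of_nonneg_left h6 hH.le
      have h8 := hφ0 p
      nlinarith
  let G : Set (Ed d) := (fun y => p + y) ⁻¹' (ball x₀ r ∩ {z | u z ≤ M - H / 4})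
  have hGm0 : MeasurableSet (ball x₀ r ∩ {z | u z ≤ M - H / 4}) :=
    measurableSet_ball.inter (hum measurableSet_Iic)
  have hGm : MeasurableSet G := (measurable_const_add p) hGm0
  have hGvol : volume G = volume (ball x₀ r ∩ {z | u z ≤ M - H / 4}) :=
    measure_preimage_add volume p _
  have hGinc : ∀ y ∈ G, u (p + y) - u p ≤ φ p - φ (p + y) + H * T y - H / 8 := by
    rintro y ⟨-, hy⟩
    have hy : u (p + y) ≤ M - H / 4 := hy
    have := mul_nonneg hH.le (hT0 y)
    have := hφ0 p
    have := hφ1 (p + y)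
    nlinarith
  have hGr : G ⊆ ball 0 (2 * r) := by
    rintro y ⟨hy, -⟩
    rw [mem_ball, dist_eq_norm] at hy
    rw [mem_ball_zero_iff]
    have h2 : ‖y‖ ≤ ‖p + y - x₀‖ + ‖p - x₀‖ := by
      calc ‖y‖ = ‖(p + y - x₀) - (p - x₀)‖ := by congr 1; abel
        _ ≤ _ := norm_sub_le _ _
    linarith
  have hGv : ENNReal.ofReal (r ^ d) * volume (ball (0 : Ed d) 1) / 2 ≤ volume G := by
    rw [hGvol]
    refine le_of_eq_of_le ?_ hG
    rw [Measure.addHaar_ball volume x₀ hr.le]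
    simp
  have hconc : ∀ y, 2 * φ p - φ (p + y) - φ (p - y) ≤ 2 * κ * H * (‖y‖ / r) ^ 2 := by
    intro y
    have h1 := hφeq p (by linarith)
    have h2 := hφl (p + y)
    have h3 := hφl (p - y)
    have h4 := parallelogram_law_with_norm ℝ (p - x₀) y
    rw [show p - x₀ + y = p + y - x₀ by abel, show p - x₀ - y = p - y - x₀ by abel] at h4
    have h5 : (‖p + y - x₀‖ / r) ^ 2 + (‖p - y - x₀‖ / r) ^ 2 =
        2 * ((‖p - x₀‖ / r) ^ 2 + (‖y‖ / r) ^ 2) := by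
      simp only [div_pow]
      field_simp
      linarith
    rw [h1]
    linear_combination h2 + h3 + κ * H * h5
  have hmain : ∀ y, u (p + y) + u (p - y) - 2 * u p ≤
      2 * κ * H * (ball (0 : Ed d) r \ {0}).indicator (fun y => (‖y‖ / r) ^ 2) y +
      2 * H * (ball (0 : Ed d) (r / 4))ᶜ.indicator
        (fun y => (8 * ‖y‖ / r) ^ α - 2 ^ (-α) + 2 * κ) y -
      H / 8 * G.indicator (fun _ => 1) y := by
    intro y
    have h1 : u (p + y) - u p ≤
        φ p - φ (p + y) + H * T y - H / 8 * G.indicator (fun _ => 1) y := by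
      by_cases hy : y ∈ G
      · rw [indicator_of_mem hy, mul_one]; exact hGinc y hy
      · rw [indicator_of_notMem hy, mul_zero, sub_zero]; exact hinc y
    have h2 := hinc (-y)
    rw [hTneg, ← sub_eq_add_neg] at h2
    suffices h : 2 * φ p - φ (p + y) - φ (p - y) + 2 * H * T y ≤
        2 * κ * H * (ball (0 : Ed d) r \ {0}).indicator (fun y => (‖y‖ / r) ^ 2) y +
        2 * H * (ball (0 : Ed d) (r / 4))ᶜ.indicator
          (fun y => (8 * ‖y‖ / r) ^ α - 2 ^ (-α) + 2 * κ) y by linarith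
    have hTle : T y ≤ (ball (0 : Ed d) (r / 4))ᶜ.indicator
        (fun y => (8 * ‖y‖ / r) ^ α - 2 ^ (-α) + 2 * κ) y :=
      indicator_le_indicator (by linarith)
    have hTle' := mul_le_mul_of_nonneg_left hTle (show 0 ≤ 2 * H by positivity)
    by_cases hy : y ∈ ball (0 : Ed d) r
    · have h3 : (ball (0 : Ed d) r \ {0}).indicator (fun y => (‖y‖ / r) ^ 2) y = (‖y‖ / r) ^ 2 := by
        by_cases hy0 : y = 0
        · simp [hy0]
        · exact indicator_of_mem (show y ∈ ball (0 : Ed d) r \ {0} from ⟨hy, hy0⟩) _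
      rw [h3]
      linarith [hconc y]
    · have h4 : y ∉ ball (0 : Ed d) r \ {0} := fun h => hy h.1
      have h5 : y ∈ (ball (0 : Ed d) (r / 4))ᶜ := by
        rw [mem_ball_zero_iff, not_lt] at hy
        rw [mem_compl_iff, mem_ball_zero_iff, not_lt]; linarith
      have h6 : T y = (8 * ‖y‖ / r) ^ α - 2 ^ (-α) + κ := indicator_of_mem h5 _
      rw [indicator_of_notMem h4, indicator_of_mem h5, h6]
      linarith [hφ1 p, hφ0 (p + y), hφ0 (p - y)]
  have hε : 0 < c / 32 * (H * r ^ (-(2 * s))) := by positivity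
  obtain ⟨K, hK, hKlt⟩ := hsub p hp _ hε
  have := integral_incr_le hd hs hlam hLam hρ hρr hα hαs hκ.le hH.le hc hconst hK
    (D := fun y => u (p + y) + u (p - y) - 2 * u p) (by fun_prop)
    ⟨b + b + 2 * b, fun y => by
      have h1 := abs_le.1 (hub (p + y))
      have h2 := abs_le.1 (hub (p - y))
      have h3 := abs_le.1 (hub p)
      rw [abs_le]; constructor <;> linarith⟩ hGm hGr hGv hmain
  linarith

/-- Decay of oscillation from a ball to the concentric ball of half the radius. -/
theorem osc_half_ball_le {d : ℕ} (hd : 1 ≤ d) {s lam Lam ρ r α κ c H A : ℝ} {x₀ : Ed d}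
    (hs : s ∈ Ioo (0 : ℝ) 1) (hlam : 0 ≤ lam) (hLam : 0 ≤ Lam) (hρ : 0 < ρ) (hρr : ρ ≤ r)
    (hα : 0 < α) (hαs : α < 2 * s) (hκ : 0 < κ) (hκ' : κ ≤ 1 / 16)
    (hακ : 1 - κ / 4 ≤ 2 ^ (-α)) (hH : 0 < H)
    (hc : c = lam * 2 ^ (-(d : ℝ) - 2 * s) * (volume (ball (0 : Ed d) 1)).toReal / 2)
    (hc0 : 0 < c)
    (hconst : Lam * (2 * κ * (2 ^ (2 * s) / (1 - 2 ^ (2 * s - 2))) + 2 * (4 ^ (2 * s) *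
      (4 ^ α / (1 - 2 ^ (α - 2 * s)) + (2 * κ - 2 ^ (-α)) / (1 - 2 ^ (-(2 * s)))))) ≤ c / 16)
    {u : Ed d → ℝ} (hum : Measurable u) {b : ℝ} (hub : ∀ z, |u z| ≤ b)
    (huc : ContinuousOn u (closedBall x₀ (3 * r / 4)))
    (hsub : ∀ x ∈ closedBall x₀ (3 * r / 4), ∀ ε : ℝ, 0 < ε → ∃ K ∈ SymClass d s lam Lam ρ,
      -A - ε < ∫ y, (u (x + y) + u (x - y) - 2 * u x) * K y)
    (hsup : ∀ x ∈ closedBall x₀ (3 * r / 4), ∀ ε : ℝ, 0 < ε → ∃ K ∈ SymClass d s lam Lam ρ,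
      (∫ y, (u (x + y) + u (x - y) - 2 * u x) * K y) < A + ε)
    (hA : A ≤ c / 32 * (H * r ^ (-(2 * s))))
    (hin : ∀ z ∈ ball x₀ r, ∀ z' ∈ ball x₀ r, u z - u z' ≤ H)
    (hout : ∀ z ∉ ball x₀ r, ∀ z' ∈ ball x₀ r, |u z - u z'| ≤ H * (2 * ‖z - x₀‖ / r) ^ α) :
    ∀ z ∈ ball x₀ (r / 2), ∀ z' ∈ ball x₀ (r / 2), u z - u z' ≤ 2 ^ (-α) * H := by
  intro z₁ hz₁ z₂ hz₂
  by_contra! hlt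
  have hr : 0 < r := hρ.trans_le hρr
  have hhalf : ball x₀ (r / 2) ⊆ ball x₀ r := ball_subset_ball (by linarith)
  have hne : (u '' ball x₀ r).Nonempty := ⟨_, mem_image_of_mem u (hhalf hz₁)⟩
  have hbd : BddAbove (u '' ball x₀ r) := ⟨b, by
    rintro _ ⟨z, -, rfl⟩; exact (abs_le.1 (hub z)).2⟩
  have hbd' : BddBelow (u '' ball x₀ r) := ⟨-b, by
    rintro _ ⟨z, -, rfl⟩; exact (abs_le.1 (hub z)).1⟩
  set M := sSup (u '' ball x₀ r)
  set m := sInf (u '' ball x₀ r)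
  have hM : ∀ z ∈ ball x₀ r, u z ≤ M := fun z hz => le_csSup hbd (mem_image_of_mem u hz)
  have hm : ∀ z ∈ ball x₀ r, m ≤ u z := fun z hz => csInf_le hbd' (mem_image_of_mem u hz)
  have hMle : ∀ B, (∀ z ∈ ball x₀ r, u z ≤ B) → M ≤ B := fun B hB =>
    csSup_le hne (by rintro _ ⟨z, hz, rfl⟩; exact hB z hz)
  have hlem : ∀ B, (∀ z ∈ ball x₀ r, B ≤ u z) → B ≤ m := fun B hB =>
    le_csInf hne (by rintro _ ⟨z, hz, rfl⟩; exact hB z hz)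
  have hMm : M - m ≤ H := by
    have : M ≤ m + H := hMle _ fun z hz => by
      have := hlem (u z - H) fun z' hz' => by linarith [hin z hz z' hz']
      linarith
    linarith
  have hMm' : 2 ^ (-α) * H < M - m := by
    linarith [hM z₁ (hhalf hz₁), hm z₂ (hhalf hz₂)]
  have hMm4 : H / 2 ≤ M - m := by nlinarith
  have hfin : (1 - κ / 4) * H ≤ 2 ^ (-α) * H := mul_le_mul_of_nonneg_right hακ hH.le
  have hcover : volume (ball x₀ r) / 2 ≤ volume (ball x₀ r ∩ {z | u z ≤ M - H / 4}) ∨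
      volume (ball x₀ r) / 2 ≤ volume (ball x₀ r ∩ {z | -u z ≤ -m - H / 4}) := by
    by_contra! hcon
    have h1 : volume (ball x₀ r) ≤ volume (ball x₀ r ∩ {z | u z ≤ M - H / 4}) +
        volume (ball x₀ r ∩ {z | -u z ≤ -m - H / 4}) := by
      refine le_trans (measure_mono fun z hz => ?_) (measure_union_le _ _)
      rcases le_total (u z) ((M + m) / 2) with h | h
      · exact Or.inl ⟨hz, show u z ≤ M - H / 4 by linarith⟩
      · exact Or.inr ⟨hz, show -u z ≤ -m - H / 4 by linarith⟩
    have h2 := ENNReal.add_lt_add hcon.1 hcon.2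
    rw [ENNReal.add_halves] at h2
    exact absurd h1 (not_le.2 h2)
  rcases hcover with hG | hG
  · have := le_sub_of_subsolution hd hs hlam hLam hρ hρr hα hαs hκ hκ' hH hc hc0 hconst hum hub huc
      hsub hA hM (fun z hz => by
        have := hlem (u z - H * (2 * ‖z - x₀‖ / r) ^ α) fun z' hz' => by
          linarith [(abs_le.1 (hout z hz z' hz')).2]
        linarith) hG z₁ hz₁
    linarith [hm z₂ (hhalf hz₂)]
  · have := le_sub_of_subsolution hd (A := A) (M := -m) hs hlam hLam hρ hρr hα hαs hκ hκ' hH hc hc0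
      hconst hum.neg (b := b) (fun z => by simpa using hub z) huc.neg
      (fun x hx ε hε => by
        obtain ⟨K, hK, hKlt⟩ := hsup x hx ε hε
        refine ⟨K, hK, ?_⟩
        have e : ∫ y, ((-u) (x + y) + (-u) (x - y) - 2 * (-u) x) * K y =
            -∫ y, (u (x + y) + u (x - y) - 2 * u x) * K y := by
          rw [← integral_neg]
          congr 1
          funext y
          simp only [Pi.neg_apply]
          ring
        rw [e]
        linarith) hA (fun z hz => neg_le_neg (hm z hz)) (fun z hz => by
        have := hMle (u z + H * (2 * ‖z - x₀‖ / r) ^ α) fun z' hz' => by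
          linarith [(abs_le.1 (hout z hz z' hz')).1]
        simp only [Pi.neg_apply]
        linarith) hG z₂ hz₂
    simp only [Pi.neg_apply] at this
    linarith [hM z₁ (hhalf hz₁)]

/-- partial Hölder regularity for bounded continuous pointwise solutions of
the extremal inequalities with symmetric integrable kernels (`ρ > 0`). -/
theorem statement19 (d : ℕ) (hd : 1 ≤ d) (s lam Lam : ℝ) (hs : s ∈ Ioo (0:ℝ) 1)
    (hlam : 0 < lam) (hlamLam : lam ≤ Lam) :
    ∃ α C : ℝ, α ∈ Ioo (0:ℝ) (2 * s) ∧ 0 < C ∧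
      ∀ ρ : ℝ, 0 < ρ → ∀ A : ℝ, 0 ≤ A → ∀ R : ℝ, 2 * ρ < R →
        ∀ u : Ed d → ℝ, Measurable u → (∃ Cb : ℝ, ∀ z : Ed d, |u z| ≤ Cb) →
          ContinuousOn u (ball (0 : Ed d) R) →
          (∀ x ∈ ball (0 : Ed d) R, ∀ ε : ℝ, 0 < ε → ∃ K ∈ SymClass d s lam Lam ρ,
            -A - ε < ∫ y, (u (x + y) + u (x - y) - 2 * u x) * K y) →
          (∀ x ∈ ball (0 : Ed d) R, ∀ ε : ℝ, 0 < ε → ∃ K ∈ SymClass d s lam Lam ρ,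
            (∫ y, (u (x + y) + u (x - y) - 2 * u x) * K y) < A + ε) →
          ∀ x ∈ ball (0 : Ed d) (R / 4), ∀ y ∈ ball (0 : Ed d) (R / 4), ρ ≤ ‖x - y‖ →
            ∀ Cb : ℝ, (∀ z : Ed d, |u z| ≤ Cb) →
              |u x - u y| / ‖x - y‖ ^ α ≤ C / R ^ α * (Cb + R ^ (2 * s) * A) := by
  have hLam : 0 < Lam := hlam.trans_le hlamLam
  set c : ℝ := lam * 2 ^ (-(d : ℝ) - 2 * s) * (volume (ball (0 : Ed d) 1)).toReal / 2 with hc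
  have hc0 : 0 < c := by
    have : 0 < (volume (ball (0 : Ed d) 1)).toReal :=
      ENNReal.toReal_pos (measure_ball_pos volume 0 one_pos).ne' measure_ball_lt_top.ne
    positivity
  obtain ⟨κ, α, hκ, hκ', hα, hαs, hακ, hconst⟩ := exists_bump_exponent (Lam := Lam) hs.1
    (show 0 < c / 16 by positivity) (2 ^ (2 * s) / (1 - 2 ^ (2 * s - 2)))
  refine ⟨α, 4 ^ α * (2 + 32 / c), ⟨hα, hαs⟩, by positivity, ?_⟩
  intro ρ hρ A hA R hR u hum _ huc hsub hsup x hx y hy hxy Cb hCb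
  have hR0 : 0 < R := by linarith
  have hxy0 : 0 < ‖x - y‖ := hρ.trans_le hxy
  rw [mem_ball_zero_iff] at hx hy
  rcases ((abs_nonneg _).trans (hCb 0)).eq_or_lt with hCb0 | hCb0
  · have hu0 : ∀ z, u z = 0 := fun z => abs_nonpos_iff.1 ((hCb z).trans hCb0.ge)
    rw [hu0, hu0, sub_zero, abs_zero, zero_div, ← hCb0]
    positivity
  set D : ℝ := (R / 2) ^ (-α) * (2 * Cb + 32 / c * A * (R / 2) ^ (2 * s)) with hD
  have hD0 : 0 < D := by positivity
  have hDR : D * (R / 2) ^ α = 2 * Cb + 32 / c * A * (R / 2) ^ (2 * s) := by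
    rw [hD, Real.rpow_neg (by positivity)]
    field_simp
  have hDA : 32 / c * A ≤ D * (R / 2) ^ (α - 2 * s) := by
    have h1 : (0 : ℝ) < (R / 2) ^ (2 * s) := by positivity
    rw [Real.rpow_sub (by positivity), ← mul_div_assoc, hDR, le_div_iff₀ h1]
    linarith
  have hclosed : ∀ r ≤ R / 2, closedBall x (3 * r / 4) ⊆ ball (0 : Ed d) R := by
    intro r hr z hz
    rw [mem_closedBall, dist_eq_norm] at hz
    rw [mem_ball_zero_iff]
    have : ‖z‖ ≤ ‖z - x‖ + ‖x‖ := by simpa using norm_add_le (z - x) x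
    linarith
  have hdecay : ∀ k : ℕ, ρ ≤ R / 2 * (1 / 2) ^ k →
      (∀ z ∈ ball x (R / 2 * (1 / 2) ^ k), ∀ z' ∈ ball x (R / 2 * (1 / 2) ^ k),
        u z - u z' ≤ D * (R / 2 * (1 / 2) ^ k) ^ α) ∧
      (∀ z ∉ ball x (R / 2 * (1 / 2) ^ k), ∀ z' ∈ ball x (R / 2 * (1 / 2) ^ k),
        |u z - u z'| ≤ D * (2 * ‖z - x‖) ^ α) := by
    intro k
    induction k with
    | zero =>
      intro _
      have h2 : ∀ z z', |u z - u z'| ≤ D * (R / 2) ^ α := fun z z' => by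
        rw [hDR]
        have h3 := abs_sub (u z) (u z')
        have h4 : 0 ≤ 32 / c * A * (R / 2) ^ (2 * s) := by positivity
        linarith [hCb z, hCb z']
      simp only [pow_zero, mul_one]
      refine ⟨fun z _ z' _ => (le_abs_self _).trans (h2 z z'), fun z hz z' _ => (h2 z z').trans ?_⟩
      rw [mem_ball, dist_eq_norm, not_lt] at hz
      gcongr
      linarith
    | succ k ih =>
      intro hk
      have hrr : R / 2 * (1 / 2) ^ (k + 1) = R / 2 * (1 / 2) ^ k / 2 := by rw [pow_succ]; ring
      rw [hrr] at hk ⊢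
      set r : ℝ := R / 2 * (1 / 2) ^ k with hr
      have hr0 : 0 < r := by positivity
      obtain ⟨ha, hb⟩ := ih (by linarith)
      have hrR : r ≤ R / 2 := mul_le_of_le_one_right (by positivity)
        (pow_le_one₀ (by norm_num) (by norm_num))
      have hHA : A ≤ c / 32 * (D * r ^ α * r ^ (-(2 * s))) := by
        rw [mul_assoc, ← Real.rpow_add hr0, ← sub_eq_add_neg]
        have h1 : (R / 2) ^ (α - 2 * s) ≤ r ^ (α - 2 * s) :=
          Real.rpow_le_rpow_of_nonpos hr0 hrR (by linarith)
        have h2 := hDA.trans (mul_le_mul_of_nonneg_left h1 hD0.le)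
        calc A = c / 32 * (32 / c * A) := by field_simp
          _ ≤ _ := mul_le_mul_of_nonneg_left h2 (by positivity)
      have hosc := osc_half_ball_le hd hs hlam.le hLam.le hρ (by linarith) hα hαs hκ hκ' hακ
        (by positivity) hc hc0 hconst hum hCb (huc.mono (hclosed r hrR))
        (fun z hz => hsub z (hclosed r hrR hz)) (fun z hz => hsup z (hclosed r hrR hz)) hHA ha
        (fun z hz z' hz' => (hb z hz z' hz').trans_eq ?_)
      · have hhalf : ball x (r / 2) ⊆ ball x r := ball_subset_ball (by linarith)
        have e : 2 ^ (-α) * (D * r ^ α) = D * (r / 2) ^ α := by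
          rw [Real.div_rpow hr0.le (by norm_num), Real.rpow_neg (by norm_num)]
          field_simp
        refine ⟨fun z hz z' hz' => (hosc z hz z' hz').trans_eq e, fun z hz z' hz' => ?_⟩
        by_cases hzr : z ∈ ball x r
        · have h1 : |u z - u z'| ≤ D * r ^ α :=
            abs_le.2 ⟨by linarith [ha z' (hhalf hz') z hzr], ha z hzr z' (hhalf hz')⟩
          refine h1.trans ?_
          rw [mem_ball, dist_eq_norm, not_lt] at hz
          gcongr
          linarith
        · exact hb z hzr z' (hhalf hz')
      · rw [Real.div_rpow (by positivity) hr0.le]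
        field_simp
  have hxyR : ‖x - y‖ < R / 2 := by linarith [norm_sub_le x y]
  obtain ⟨k, hk1, hk2⟩ := exists_half_pow_near (x := ‖x - y‖ / (R / 2)) (by positivity)
    ((div_lt_one (by positivity)).2 hxyR)
  rw [le_div_iff₀ (by positivity), pow_succ] at hk1
  rw [div_lt_iff₀ (by positivity)] at hk2
  have hρk : ρ ≤ R / 2 * (1 / 2) ^ k := by linarith
  have hosc := (hdecay k hρk).1
  have hxk : x ∈ ball x (R / 2 * (1 / 2) ^ k) := mem_ball_self (by positivity)
  have hyk : y ∈ ball x (R / 2 * (1 / 2) ^ k) := by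
    rw [mem_ball, dist_eq_norm, norm_sub_rev]; linarith
  have h1 : |u x - u y| ≤ D * (R / 2 * (1 / 2) ^ k) ^ α :=
    abs_le.2 ⟨by linarith [hosc y hyk x hxk], hosc x hxk y hyk⟩
  have h2 : (R / 2 * (1 / 2) ^ k) ^ α ≤ 2 ^ α * ‖x - y‖ ^ α := by
    rw [← Real.mul_rpow (by norm_num) hxy0.le]
    exact Real.rpow_le_rpow (by positivity) (by linarith) hα.le
  rw [div_le_iff₀ (by positivity)]
  refine h1.trans ((mul_le_mul_of_nonneg_left h2 hD0.le).trans ?_)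
  have h3 : (R / 2) ^ (2 * s) ≤ R ^ (2 * s) :=
    Real.rpow_le_rpow (by positivity) (by linarith) (by linarith [hs.1])
  have h4 : 2 * Cb + 32 / c * A * (R / 2) ^ (2 * s) ≤ (2 + 32 / c) * (Cb + R ^ (2 * s) * A) := by
    have h5 := mul_le_mul_of_nonneg_left h3 (show 0 ≤ 32 / c * A by positivity)
    have h6 : 0 ≤ 32 / c * Cb := by positivity
    have h7 : 0 ≤ R ^ (2 * s) * A := by positivity
    linarith
  have h8 : (R / 2) ^ (-α) * 2 ^ α = 4 ^ α / R ^ α := by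
    rw [Real.rpow_neg (by positivity), Real.div_rpow hR0.le (by norm_num), inv_div,
      show (4 : ℝ) = 2 * 2 by norm_num, Real.mul_rpow (by norm_num) (by norm_num)]
    ring
  calc D * (2 ^ α * ‖x - y‖ ^ α)
      = ((R / 2) ^ (-α) * 2 ^ α) * (2 * Cb + 32 / c * A * (R / 2) ^ (2 * s)) * ‖x - y‖ ^ α := by
        rw [hD]; ring
    _ ≤ ((R / 2) ^ (-α) * 2 ^ α) * ((2 + 32 / c) * (Cb + R ^ (2 * s) * A)) * ‖x - y‖ ^ α := by
        gcongr
    _ = _ := by rw [h8]; ring
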